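/- Let F_L be a distribution function on ℝ with mean zero whose support is bounded above, and suppose F_L(x) ≤ D(-x) for all x ≤ t₀ < 0, where D is a nonnegative, nonincreasing function regularly varying at +∞ of index -α with 1 < α < 2. Then, as λ ↓ 0, ∫ e^{λx} dF_L(x) ≤ 1 + D(1/λ)·(∫_0^∞ (1-e^{-u})/u^α du)·(1 + o(1)). -/

import Mathlib

open Filter Set MeasureTheory

lemma potter (G : ℝ → ℝ) (anti : Antitone G) (nonneg : ∀ t, 0 ≤ G t) (α β γ : ℝ)
    (hβ0 : 0 < β) (hβ : β < α) (hγ : α < γ)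
    (hRV : ∀ l : ℝ, 0 < l →
      Tendsto (fun t : ℝ => G (l * t) / G t) atTop (nhds (l ^ (-α)))) :
    ∃ T > 0, ∃ C > 0, ∀ t ≥ T, 0 < G t ∧ 
      ∀ u > 0, G (u * t) ≤ C * (u ^ (-β) + u ^ (-γ)) * G t := by
  have hpos : ∀ᶠ t in atTop, 0 < G t := by
    have h1 := hRV 1 one_pos
    rw [Real.one_rpow] at h1
    filter_upwards [h1.eventually (lt_mem_nhds (zero_lt_one))] with t ht
    rcases (nonneg t).eq_or_lt with h | h
    · rw [← h] at ht; simp at ht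
    · exact h
  have hup : ∀ᶠ t in atTop, G (2 * t) / G t < 2 ^ (-β) :=
    (hRV 2 two_pos).eventually (gt_mem_nhds
      (Real.rpow_lt_rpow_of_exponent_lt one_lt_two (by linarith)))
  have hlo : ∀ᶠ t in atTop, 2 ^ (-γ) < G (2 * t) / G t :=
    (hRV 2 two_pos).eventually (lt_mem_nhds
      (Real.rpow_lt_rpow_of_exponent_lt one_lt_two (by linarith)))
  obtain ⟨T0, hT0⟩ := eventually_atTop.1 (hpos.and (hup.and hlo))
  set T := max T0 1 with hTdef
  have hT1 : 1 ≤ T := le_max_right _ _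
  have hT : ∀ t ≥ T, 0 < G t ∧ G (2 * t) ≤ 2 ^ (-β) * G t ∧ 2 ^ (-γ) * G t ≤ G (2 * t) := by
    intro t ht
    obtain ⟨a, b, c⟩ := hT0 t ((le_max_left _ _).trans ht)
    exact ⟨a, ((div_lt_iff₀ a).1 b).le, ((lt_div_iff₀ a).1 c).le⟩
  have hge : ∀ n : ℕ, ∀ t ≥ T, T ≤ 2 ^ n * t := by
    intro n t ht
    have : (1:ℝ) ≤ 2 ^ n := one_le_pow₀ (by norm_num)
    nlinarith
  have iup : ∀ n : ℕ, ∀ t ≥ T, G (2 ^ n * t) ≤ ((2:ℝ) ^ n) ^ (-β) * G t := by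
    intro n t ht
    induction n with
    | zero => simp
    | succ k ih =>
      have h := (hT _ (hge k t ht)).2.1
      have e : (2:ℝ) ^ (k+1) * t = 2 * (2 ^ k * t) := by ring
      rw [e, pow_succ, Real.mul_rpow (by positivity) (by positivity)]
      calc _ ≤ _ := h
        _ ≤ 2 ^ (-β) * (((2:ℝ) ^ k) ^ (-β) * G t) := by gcongr
        _ = _ := by ring
  have ilo : ∀ n : ℕ, ∀ t ≥ T, ((2:ℝ) ^ n) ^ (-γ) * G t ≤ G (2 ^ n * t) := by
    intro n t ht
    induction n with
    | zero => simp
    | succ k ih =>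
      have h := (hT _ (hge k t ht)).2.2
      have e : (2:ℝ) ^ (k+1) * t = 2 * (2 ^ k * t) := by ring
      rw [e, pow_succ, Real.mul_rpow (by positivity) (by positivity)]
      calc _ = 2 ^ (-γ) * (((2:ℝ) ^ k) ^ (-γ) * G t) := by ring
        _ ≤ 2 ^ (-γ) * G (2 ^ k * t) := by gcongr
        _ ≤ _ := h
  have pup : ∀ v ≥ 1, ∀ t ≥ T, G (v * t) ≤ 2 ^ β * v ^ (-β) * G t := by
    intro v hv t ht
    obtain ⟨n, hn1, hn2⟩ := exists_nat_pow_near hv (one_lt_two)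
    have ht0 : 0 < t := by linarith
    calc G (v * t) ≤ G (2 ^ n * t) := anti (by gcongr)
      _ ≤ ((2:ℝ) ^ n) ^ (-β) * G t := iup n t ht
      _ ≤ (v / 2) ^ (-β) * G t := by
        gcongr ?_ * _
        · exact nonneg t
        apply Real.rpow_le_rpow_of_nonpos (by positivity) _ (by linarith)
        rw [pow_succ] at hn2; linarith
      _ = _ := by
        rw [Real.div_rpow (by linarith) (by norm_num), Real.rpow_neg (x := 2) (by norm_num)]
        field_simp
  have plo : ∀ v ≥ 1, ∀ t ≥ T, G t ≤ 2 ^ γ * v ^ γ * G (v * t) := by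
    intro v hv t ht
    obtain ⟨n, hn1, hn2⟩ := exists_nat_pow_near hv (one_lt_two)
    have ht0 : 0 < t := by linarith
    have h1 : ((2:ℝ) ^ (n+1)) ^ (-γ) * G t ≤ G (v * t) :=
      (ilo (n+1) t ht).trans (anti (by gcongr))
    have h2 : (2 * v) ^ (-γ) * G t ≤ G (v * t) := by
      refine le_trans ?_ h1
      gcongr ?_ * _
      · exact nonneg t
      apply Real.rpow_le_rpow_of_nonpos (by positivity) _ (by linarith)
      rw [pow_succ]; linarith
    rw [Real.rpow_neg (by positivity), inv_mul_le_iff₀ (by positivity),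
      Real.mul_rpow (by norm_num) (by linarith)] at h2
    exact h2
  have hTpos : 0 < T := by linarith
  have hGT := (hT T le_rfl).1
  refine ⟨T, hTpos, 2 ^ β + 2 ^ γ + G 0 / G T * 2 ^ γ, ?_, fun t ht => ⟨(hT t ht).1, ?_⟩⟩
  · have := nonneg 0
    positivity
  intro u hu
  have hG0 := nonneg 0
  have hGt := (hT t ht).1
  have ht0 : 0 < t := by linarith
  have huβ : 0 < u ^ (-β) := by positivity
  have huγ : 0 < u ^ (-γ) := by positivity
  have hCG : 0 ≤ G 0 / G T * 2 ^ γ := by positivity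
  have h2β : (0:ℝ) < 2 ^ β := by positivity
  have h2γ : (0:ℝ) < 2 ^ γ := by positivity
  have key : G (u * t) ≤ 2 ^ β * u ^ (-β) * G t ∨ G (u * t) ≤ 2 ^ γ * u ^ (-γ) * G t ∨
      G (u * t) ≤ (G 0 / G T * 2 ^ γ) * u ^ (-γ) * G t := by
    rcases le_or_gt 1 u with h | h
    · exact Or.inl (pup u h t ht)
    right
    rcases le_or_gt T (u * t) with h' | h'
    · left
      have := plo u⁻¹ ((one_le_inv₀ hu).2 h.le) (u * t) h'
      rwa [inv_mul_cancel_left₀ hu.ne', Real.inv_rpow hu.le, ← Real.rpow_neg hu.le] at this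
    · right
      have := plo (t / T) ((one_le_div₀ hTpos).2 ht) T le_rfl
      rw [div_mul_cancel₀ _ hTpos.ne'] at this
      have h3 : (t / T) ^ γ ≤ u ^ (-γ) := by
        rw [Real.rpow_neg hu.le, ← Real.inv_rpow hu.le]
        apply Real.rpow_le_rpow (by positivity) _ (by linarith)
        rw [div_le_iff₀ hTpos, ← div_eq_inv_mul, le_div_iff₀ hu]
        linarith
      calc G (u * t) ≤ G 0 := anti (by positivity)
        _ = G 0 / G T * G T := by field_simp
        _ ≤ G 0 / G T * (2 ^ γ * (t / T) ^ γ * G t) := by gcongr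
        _ ≤ G 0 / G T * (2 ^ γ * u ^ (-γ) * G t) := by gcongr
        _ = _ := by ring
  have e1 : 0 ≤ 2 ^ β * u ^ (-β) * G t := by positivity
  have e2 : 0 ≤ 2 ^ γ * u ^ (-γ) * G t := by positivity
  have e3 : 0 ≤ (G 0 / G T * 2 ^ γ) * u ^ (-γ) * G t := by positivity
  have e4 : 0 ≤ 2 ^ β * u ^ (-γ) * G t := by positivity
  have e5 : 0 ≤ 2 ^ γ * u ^ (-β) * G t := by positivity
  have e6 : 0 ≤ (G 0 / G T * 2 ^ γ) * u ^ (-β) * G t := by positivity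
  have : (2 ^ β + 2 ^ γ + G 0 / G T * 2 ^ γ) * (u ^ (-β) + u ^ (-γ)) * G t =
    2 ^ β * u ^ (-β) * G t + 2 ^ γ * u ^ (-γ) * G t + (G 0 / G T * 2 ^ γ) * u ^ (-γ) * G t
    + 2 ^ β * u ^ (-γ) * G t + 2 ^ γ * u ^ (-β) * G t + (G 0 / G T * 2 ^ γ) * u ^ (-β) * G t := by
    ring
  rw [this]
  rcases key with h | h | h <;> linarith

lemma integ (p : ℝ) (h1 : 1 < p) (h2 : p < 2) :
    IntegrableOn (fun u : ℝ => (1 - Real.exp (-u)) * u ^ (-p)) (Ioi 0) := by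
  have hm : Measurable (fun u : ℝ => (1 - Real.exp (-u)) * u ^ (-p)) := by fun_prop
  rw [← Ioc_union_Ioi_eq_Ioi (zero_le_one' ℝ)]
  refine IntegrableOn.union ?_ ?_
  · have h : IntegrableOn (fun u : ℝ => u ^ (1-p)) (Ioc 0 1) := by
      have := intervalIntegral.intervalIntegrable_rpow' (a := 0) (b := 1) (r := 1 - p) (by linarith)
      rwa [intervalIntegrable_iff_integrableOn_Ioc_of_le zero_le_one] at this
    refine Integrable.mono' h hm.aestronglyMeasurable ?_
    refine (ae_restrict_iff' measurableSet_Ioc).2 (ae_of_all _ fun u hu => ?_)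
    have h0 : 0 ≤ 1 - Real.exp (-u) := by
      have := Real.exp_le_one_iff.2 (show -u ≤ 0 by linarith [hu.1]); linarith
    have h3 : 1 - Real.exp (-u) ≤ u := by have := Real.add_one_le_exp (-u); linarith
    have h4 : 0 ≤ u ^ (-p) := Real.rpow_nonneg hu.1.le _
    rw [Real.norm_of_nonneg (by positivity), sub_eq_add_neg 1 p, Real.rpow_add hu.1, Real.rpow_one]
    gcongr
  · have h := integrableOn_Ioi_rpow_of_lt (a := -p) (by linarith) one_pos
    refine Integrable.mono' h hm.aestronglyMeasurable ?_
    refine (ae_restrict_iff' measurableSet_Ioi).2 (ae_of_all _ fun u hu => ?_)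
    have hu : 1 < u := hu
    have h0 : 0 ≤ 1 - Real.exp (-u) := by
      have := Real.exp_le_one_iff.2 (show -u ≤ 0 by linarith); linarith
    have h3 : 1 - Real.exp (-u) ≤ 1 := by have := Real.exp_pos (-u); linarith
    have h4 : 0 ≤ u ^ (-p) := Real.rpow_nonneg (by linarith) _
    rw [Real.norm_of_nonneg (by positivity)]
    nlinarith


lemma core (ν : Measure ℝ) [IsProbabilityMeasure ν]
    (hint : Integrable (fun x : ℝ => x) ν)
    (hcent : ∫ x, x ∂ν = 0)
    (M : ℝ) (hM : 0 ≤ M) (hsupp : ν (Ioi M) = 0) (l : ℝ) (hl : 0 < l) (hlM : l * M ≤ 1)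
    (G : ℝ → ℝ) (nonneg : ∀ t, 0 ≤ G t)
    (htail : ∀ t > 0, (ν (Iic (-t))).toReal ≤ G t)
    (hi : IntegrableOn (fun t => G t * (l * (1 - Real.exp (-(l * t))))) (Ioi 0)) :
    (∫ x, Real.exp (l * x) ∂ν) ≤ 
      1 + l ^ 2 * M ^ 2 + ∫ t in Ioi 0, G t * (l * (1 - Real.exp (-(l * t)))) := by
  have hae : ∀ᵐ x ∂ν, x ≤ M := by
    rw [ae_iff]; convert hsupp using 2; ext x; simp
  have hexp : Integrable (fun x => Real.exp (l * x)) ν := by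
    refine Integrable.mono' (integrable_const (Real.exp (l * M))) (by fun_prop) ?_
    filter_upwards [hae] with x hx
    rw [Real.norm_of_nonneg (Real.exp_pos _).le]
    gcongr
  set f : ℝ → ℝ := fun x => max (-x) 0 with hf
  set k : ℝ → ℝ := fun x => Real.exp (-(l * f x)) - 1 + l * f x with hk
  have hfm : Measurable f := by fun_prop
  have hfi : Integrable f ν := hint.neg.pos_part
  have hf0 : ∀ x, 0 ≤ f x := fun x => le_max_right _ _
  have hkm : Measurable k := by fun_prop
  have hk0 : ∀ x, 0 ≤ k x := by
    intro x
    have := Real.add_one_le_exp (-(l * f x))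
    simp only [hk]; linarith
  have hki : Integrable k ν := by
    refine Integrable.add (Integrable.sub ?_ (integrable_const _)) (hfi.const_mul l)
    refine Integrable.mono' (integrable_const 1) (by fun_prop) (ae_of_all _ fun x => ?_)
    rw [Real.norm_of_nonneg (Real.exp_pos _).le, Real.exp_le_one_iff]
    have := hf0 x
    have : 0 ≤ l * f x := by positivity
    linarith
  have h1 : ∫ x, Real.exp (l * x) ∂ν = 1 + ∫ x, (Real.exp (l * x) - 1 - l * x) ∂ν := by
    have hA : Integrable (fun x => Real.exp (l * x) - 1) ν := hexp.sub (integrable_const _)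
    rw [integral_sub hA (hint.const_mul l),
      integral_sub hexp (integrable_const _), integral_const_mul, hcent]
    simp
  have h2 : ∫ x, (Real.exp (l * x) - 1 - l * x) ∂ν ≤ ∫ x, (l ^ 2 * M ^ 2 + k x) ∂ν := by
    refine integral_mono_ae ((hexp.sub (integrable_const _)).sub (hint.const_mul l))
      ((integrable_const _).add hki) ?_
    filter_upwards [hae] with x hx
    simp only [hk, hf]
    rcases le_total x 0 with h | h
    · rw [max_eq_left (by linarith)]
      have : 0 ≤ l ^ 2 * M ^ 2 := by positivity
      have e : -(l * -x) = l * x := by ring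
      rw [e]; linarith
    · rw [max_eq_right (by linarith)]
      have h0 : 0 ≤ l * x := by positivity
      have h5 : l * x ≤ l * M := by gcongr
      have h3 := Real.abs_exp_sub_one_sub_id_le (x := l * x) (by rw [abs_of_nonneg h0]; linarith)
      have h4 := le_abs_self (Real.exp (l * x) - 1 - l * x)
      have : (l * x) ^ 2 ≤ (l * M) ^ 2 := by gcongr
      simp only [mul_zero, neg_zero, Real.exp_zero]
      nlinarith
  have h3 : ∫ x, (l ^ 2 * M ^ 2 + k x) ∂ν = l ^ 2 * M ^ 2 + ∫ x, k x ∂ν := by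
    rw [integral_add (integrable_const _) hki]; simp
  have hg0 : ∀ t > 0, 0 ≤ l * (1 - Real.exp (-(l * t))) := by
    intro t ht
    have : Real.exp (-(l * t)) ≤ 1 := by rw [Real.exp_le_one_iff]; have : 0 < l * t := by positivity
                                         linarith
    have : 0 ≤ 1 - Real.exp (-(l * t)) := by linarith
    positivity
  have h4 : ∫ x, k x ∂ν ≤ ∫ t in Ioi 0, G t * (l * (1 - Real.exp (-(l * t)))) := by
    rw [integral_eq_lintegral_of_nonneg_ae (ae_of_all _ hk0) hkm.aestronglyMeasurable]
    have hkk : ∀ x, k x = ∫ t in (0:ℝ)..f x, l * (1 - Real.exp (-(l * t))) := by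
      intro x
      rw [intervalIntegral.integral_eq_sub_of_hasDerivAt 
        (f := fun t => Real.exp (-(l * t)) + l * t)]
      · simp [hk]; ring
      · intro t _
        have := (((hasDerivAt_id t).const_mul l).neg.exp).add ((hasDerivAt_id t).const_mul l)
        refine this.congr_deriv ?_
        simp; ring
      · exact Continuous.intervalIntegrable (by fun_prop) _ _
    simp_rw [hkk]
    rw [lintegral_comp_eq_lintegral_meas_le_mul ν (ae_of_all _ hf0) hfm.aemeasurable
      (fun t _ => Continuous.intervalIntegrable (by fun_prop) _ _)
      ((ae_restrict_iff' measurableSet_Ioi).2 (ae_of_all _ hg0))]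
    refine ENNReal.toReal_le_of_le_ofReal ?_ ?_
    · exact setIntegral_nonneg measurableSet_Ioi fun t ht => mul_nonneg (nonneg t) (hg0 t ht)
    rw [ofReal_integral_eq_lintegral_ofReal hi ((ae_restrict_iff' measurableSet_Ioi).2
      (ae_of_all _ fun t ht => mul_nonneg (nonneg t) (hg0 t ht)))]
    refine setLIntegral_mono' measurableSet_Ioi fun t ht => ?_
    rw [ENNReal.ofReal_mul (nonneg t)]
    gcongr
    have : {a | t ≤ f a} = Iic (-t) := by
      ext a
      have ht : 0 < t := ht
      simp only [hf, mem_ofPred_eq, mem_Iic, le_max_iff]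
      constructor
      · rintro (h | h) <;> linarith
      · intro h; left; linarith
    rw [this]
    exact (ENNReal.le_ofReal_iff_toReal_le (measure_ne_top _ _) (nonneg t)).2 (htail t ht)
  linarith

lemma mainG (ν : Measure ℝ) [IsProbabilityMeasure ν]
    (hint : Integrable (fun x : ℝ => x) ν)
    (hcent : ∫ x, x ∂ν = 0)
    (M : ℝ) (hM : 0 ≤ M) (hsupp : ν (Ioi M) = 0)
    (α : ℝ) (hα1 : 1 < α) (hα2 : α < 2)
    (G : ℝ → ℝ) (anti : Antitone G) (nonneg : ∀ t, 0 ≤ G t)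
    (hRV : ∀ l : ℝ, 0 < l →
      Tendsto (fun t : ℝ => G (l * t) / G t) atTop (nhds (l ^ (-α))))
    (htail : ∀ t > 0, (ν (Iic (-t))).toReal ≤ G t) :
    ∃ err : ℝ → ℝ,
      Tendsto err (nhdsWithin 0 (Ioi (0 : ℝ))) (nhds 0) ∧
      ∀ᶠ l in nhdsWithin 0 (Ioi (0 : ℝ)),
        (∫ x, Real.exp (l * x) ∂ν) ≤
          1 + G (1 / l) * (∫ u in Ioi (0 : ℝ), (1 - Real.exp (-u)) / u ^ α) * (1 + err l) := by
  obtain ⟨β, hβ1, hβ2⟩ := exists_between hα1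
  obtain ⟨γ, hγ1, hγ2⟩ := exists_between hα2
  obtain ⟨T, hT, C, hC, hP⟩ := potter G anti nonneg α β γ (by linarith) hβ2 hγ1 hRV
  have hGpos : ∀ t, 0 < G t := fun t =>
    (hP (max t T) (le_max_right _ _)).1.trans_le (anti (le_max_left _ _))
  have hgm : Measurable G := anti.measurable
  have hexp0 : ∀ u : ℝ, 0 < u → 0 < 1 - Real.exp (-u) := by
    intro u hu
    have := Real.exp_lt_one_iff.2 (show -u < 0 by linarith)
    linarith
  set K := ∫ u in Ioi (0 : ℝ), (1 - Real.exp (-u)) / u ^ α with hK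
  have hKeq : K = ∫ u in Ioi (0 : ℝ), u ^ (-α) * (1 - Real.exp (-u)) := by
    refine setIntegral_congr_fun measurableSet_Ioi fun u hu => ?_
    have hu : 0 < u := hu
    simp only [Real.rpow_neg hu.le]
    field_simp
  have hKpos : 0 < K := by
    rw [hKeq, setIntegral_pos_iff_support_of_nonneg_ae]
    · refine lt_of_lt_of_le (b := volume (Ioi (0:ℝ))) (by simp) (measure_mono fun u hu => ⟨?_, hu⟩)
      have h1 := hexp0 u hu
      have hu : 0 < u := hu
      have : 0 < u ^ (-α) * (1 - Real.exp (-u)) := by positivity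
      exact this.ne'
    · refine (ae_restrict_iff' measurableSet_Ioi).2 (ae_of_all _ fun u hu => ?_)
      have h1 := hexp0 u hu
      have hu : 0 < u := hu
      simp only [Pi.zero_apply]
      positivity
    · simpa only [mul_comm] using integ α hα1 hα2
  set F : ℝ → ℝ → ℝ := fun t u => G (u * t) / G t * (1 - Real.exp (-u)) with hF
  have hFm : ∀ t, Measurable (F t) := by
    intro t
    have : Measurable (fun u => G (u * t)) := hgm.comp (by fun_prop)
    simp only [hF]; fun_prop
  set bd : ℝ → ℝ := fun u =>
    C * ((1 - Real.exp (-u)) * u ^ (-β) + (1 - Real.exp (-u)) * u ^ (-γ)) with hbd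
  have hbdi : IntegrableOn bd (Ioi 0) :=
    ((integ β hβ1 (by linarith)).add (integ γ (by linarith) hγ2)).const_mul C
  have hbound : ∀ t ≥ T, ∀ᵐ u ∂(volume.restrict (Ioi (0:ℝ))), ‖F t u‖ ≤ bd u := by
    intro t ht
    refine (ae_restrict_iff' measurableSet_Ioi).2 (ae_of_all _ fun u hu => ?_)
    have h1 := hexp0 u hu
    have hu : 0 < u := hu
    have h2 := hGpos t
    have h3 := nonneg (u * t)
    have h4 := (hP t ht).2 u hu
    simp only [hF, hbd]
    rw [Real.norm_of_nonneg (by positivity)]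
    rw [← div_le_iff₀ h2] at h4
    calc _ ≤ C * (u ^ (-β) + u ^ (-γ)) * (1 - Real.exp (-u)) := by gcongr
      _ = _ := by ring
  have hFi : ∀ t ≥ T, IntegrableOn (F t) (Ioi 0) := fun t ht =>
    Integrable.mono' hbdi (hFm t).aestronglyMeasurable (hbound t ht)
  have hJ : Tendsto (fun t => ∫ u in Ioi 0, F t u) atTop (nhds K) := by
    rw [hKeq]
    refine tendsto_integral_filter_of_dominated_convergence bd
      (Eventually.of_forall fun t => (hFm t).aestronglyMeasurable) ?_ hbdi ?_
    · filter_upwards [eventually_ge_atTop T] with t ht using hbound t ht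
    · refine (ae_restrict_iff' measurableSet_Ioi).2 (ae_of_all _ fun u hu => ?_)
      exact (hRV u hu).mul_const _
  have hinv : Tendsto (fun l : ℝ => 1 / l) (nhdsWithin 0 (Ioi (0:ℝ))) atTop := by
    simpa only [one_div] using tendsto_inv_nhdsGT_zero (𝕜 := ℝ)
  have hev : ∀ᶠ l in nhdsWithin 0 (Ioi (0 : ℝ)), 0 < l ∧ T ≤ 1 / l ∧ l * M ≤ 1 := by
    refine (eventually_mem_nhdsWithin).and ((hinv.eventually_ge_atTop T).and ?_)
    filter_upwards [hinv.eventually_ge_atTop M, eventually_mem_nhdsWithin] with l h1 h2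
    rw [le_div_iff₀ h2] at h1
    linarith
  have hsq : Tendsto (fun l : ℝ => l ^ 2 * M ^ 2 / G (1 / l)) (nhdsWithin 0 (Ioi (0:ℝ)))
      (nhds 0) := by
    have hlim : Tendsto (fun l : ℝ => M ^ 2 * C / G 1 * (l ^ (2 - β) + l ^ (2 - γ)))
        (nhdsWithin 0 (Ioi (0:ℝ))) (nhds 0) := by
      have hc : ∀ p : ℝ, 0 < p → Tendsto (fun l : ℝ => l ^ p) (nhdsWithin 0 (Ioi (0:ℝ)))
          (nhds 0) := by
        intro p hp
        have := (Real.continuousAt_rpow_const 0 p (Or.inr hp.le)).tendsto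
        rw [Real.zero_rpow hp.ne'] at this
        exact this.mono_left nhdsWithin_le_nhds
      have := ((hc (2 - β) (by linarith)).add (hc (2 - γ) (by linarith))).const_mul
        (M ^ 2 * C / G 1)
      simpa using this
    refine squeeze_zero' ?_ ?_ hlim
    · filter_upwards with l
      have := hGpos (1 / l)
      positivity
    · filter_upwards [hev] with l ⟨hl, hlT, _⟩
      have h1 := (hP _ hlT).2 l hl
      rw [mul_one_div_cancel hl.ne'] at h1
      have h2 := hGpos (1 / l)
      have h3 := hGpos 1
      have e : ∀ p : ℝ, l ^ (2 - p) = l ^ 2 * l ^ (-p) := by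
        intro p
        rw [sub_eq_add_neg, Real.rpow_add hl]
        norm_cast
      rw [e, e, div_le_iff₀ h2]
      have h4 : l ^ 2 * M ^ 2 / G 1 * G 1 ≤
        l ^ 2 * M ^ 2 / G 1 * (C * (l ^ (-β) + l ^ (-γ)) * G (1 / l)) := by gcongr
      rw [div_mul_cancel₀ _ h3.ne'] at h4
      refine h4.trans (le_of_eq ?_)
      ring
  refine ⟨fun l => (l ^ 2 * M ^ 2 / G (1 / l) + ∫ u in Ioi 0, F (1 / l) u) / K - 1, ?_, ?_⟩
  · have := ((hsq.add (hJ.comp hinv)).div_const K).sub_const 1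
    simpa [hKpos.ne'] using this
  · filter_upwards [hev] with l ⟨hl, hlT, hlM⟩
    have h2 := hGpos (1 / l)
    have hcomp : ∀ t, G t * (l * (1 - Real.exp (-(l * t)))) =
        (l * G (1 / l)) * F (1 / l) (l * t) := by
      intro t
      simp only [hF]
      have : l * t * (1 / l) = t := by field_simp
      rw [this]; field_simp
    have hi : IntegrableOn (fun t => G t * (l * (1 - Real.exp (-(l * t))))) (Ioi 0) := by
      simp_rw [hcomp]
      refine Integrable.const_mul ?_ _
      have := (integrableOn_Ioi_comp_mul_left_iff (F (1 / l)) 0 hl).2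
        (by rw [mul_zero]; exact hFi _ hlT)
      exact this
    have hc := core ν hint hcent M hM hsupp l hl hlM G nonneg htail hi
    simp_rw [hcomp] at hc
    rw [integral_const_mul, integral_comp_mul_left_Ioi _ _ hl, mul_zero, smul_eq_mul] at hc
    refine hc.trans (le_of_eq ?_)
    field_simp
    ring

/-- mgf bound. If `F_L` is the cdf of a centered probability measure with
support bounded above, whose lower tail is dominated by a function `D` regularly varying
of index `-α`, `α ∈ (1,2)`, then as `λ ↓ 0`,
`∫ e^{λx} dF_L(x) ≤ 1 + D(1/λ) ∫_0^∞ (1-e^{-u}) u^{-α} du (1 + o(1))`. -/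
theorem stmt7 (ν : Measure ℝ) [IsProbabilityMeasure ν]
    (hint : Integrable (fun x : ℝ => x) ν)
    (hcent : ∫ x, x ∂ν = 0)
    (M : ℝ) (hsupp : ν (Ioi M) = 0)
    (α : ℝ) (hα1 : 1 < α) (hα2 : α < 2)
    (t₀ : ℝ) (ht₀ : t₀ < 0)
    (D : ℝ → ℝ) (hD_nonneg : ∀ t, 0 < t → 0 ≤ D t)
    (hD_anti : AntitoneOn D (Ioi (0 : ℝ)))
    (hD_RV : ∀ l : ℝ, 0 < l →
      Tendsto (fun t : ℝ => D (l * t) / D t) atTop (nhds (l ^ (-α))))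
    (htail : ∀ x : ℝ, x ≤ t₀ → (ν (Iic x)).toReal ≤ D (-x)) :
    ∃ err : ℝ → ℝ,
      Tendsto err (nhdsWithin 0 (Ioi (0 : ℝ))) (nhds 0) ∧
      ∀ᶠ l in nhdsWithin 0 (Ioi (0 : ℝ)),
        (∫ x, Real.exp (l * x) ∂ν) ≤
          1 + D (1 / l) * (∫ u in Ioi (0 : ℝ), (1 - Real.exp (-u)) / u ^ α) * (1 + err l) := by
  
  set T := max (-t₀) 1 with hTd
  have hT1 : 1 ≤ T := le_max_right _ _
  have hTt : -t₀ ≤ T := le_max_left _ _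
  set A := max 1 (D T) with hA
  set G : ℝ → ℝ := fun t => if t < T then A else D t with hG
  have hGD : ∀ t, T ≤ t → G t = D t := fun t ht => by simp only [hG, if_neg (not_lt.2 ht)]
  have hGA : ∀ t, t < T → G t = A := fun t ht => by simp only [hG, if_pos ht]
  have hDle : ∀ t, T ≤ t → D t ≤ A := fun t ht =>
    (hD_anti (show (0:ℝ) < T by linarith) (show (0:ℝ) < t by linarith) ht).trans (le_max_right _ _)
  have anti : Antitone G := by
    intro a b hab
    rcases lt_or_ge b T with hb | hb
    · rw [hGA b hb, hGA a (by linarith)]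
    · rw [hGD b hb]
      rcases lt_or_ge a T with ha | ha
      · rw [hGA a ha]; exact hDle b hb
      · rw [hGD a ha]
        exact hD_anti (show (0:ℝ) < a by linarith) (show (0:ℝ) < b by linarith) hab
  have nonneg : ∀ t, 0 ≤ G t := by
    intro t
    rcases lt_or_ge t T with ht | ht
    · rw [hGA t ht]; exact zero_le_one.trans (le_max_left _ _)
    · rw [hGD t ht]; exact hD_nonneg t (by linarith)
  have hRV : ∀ l : ℝ, 0 < l →
      Tendsto (fun t : ℝ => G (l * t) / G t) atTop (nhds (l ^ (-α))) := by
    intro l hl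
    refine (hD_RV l hl).congr' ?_
    filter_upwards [eventually_ge_atTop T,
      (tendsto_id.const_mul_atTop hl).eventually_ge_atTop T] with t h1 h2
    rw [hGD t h1, hGD (l * t) h2]
  have ht : ∀ t > 0, (ν (Iic (-t))).toReal ≤ G t := by
    intro t ht
    rcases lt_or_ge t T with h | h
    · rw [hGA t h]
      refine le_trans ?_ (le_max_left _ _)
      exact ENNReal.toReal_le_of_le_ofReal zero_le_one (by simpa using prob_le_one)
    · rw [hGD t h]
      have := htail (-t) (by linarith)
      rwa [neg_neg] at this
  have hs : ν (Ioi (max M 0)) = 0 := measure_mono_null (Ioi_subset_Ioi (le_max_left _ _)) hsupp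
  obtain ⟨err, h1, h2⟩ := mainG ν hint hcent (max M 0) (le_max_right _ _) hs α hα1 hα2 G anti
    nonneg hRV ht
  refine ⟨err, h1, ?_⟩
  have hinv : Tendsto (fun l : ℝ => 1 / l) (nhdsWithin 0 (Ioi (0:ℝ))) atTop := by
    simpa only [one_div] using tendsto_inv_nhdsGT_zero (𝕜 := ℝ)
  filter_upwards [h2, hinv.eventually_ge_atTop T] with l h3 h4
  rwa [hGD _ h4] at h3
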